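/- Finite Landauer-erasure bound (Theorem 1), explicit-protocol form: Let d ≥ 2 be an integer, ε ∈ (0, 1/2], η ∈ (0, 1], and let ρ be a density matrix on ℂ^d. Set T := ⌈((e+1)/(e·η))·ln((e+1)·(d−1)²/(ε·η))⌉. Let ρ'_ε be the target erasure state, and let ρ_t (t = 0,…,T) be the straight-line erasure path from ρ to ρ'_ε with dimensionless protocol heat βQ := Σ_{t=1}^T Re tr[(ρ_t − ρ_{t−1})·log ρ_t]. Then: (i) the final state satisfies 1 − ⟨e₀, ρ'_ε e₀⟩ = ε; (ii) S(ρ) − S(ρ'_ε) ≤ βQ; and (iii) βQ − (S(ρ) − S(ρ'_ε)) ≤ η. -/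

import Mathlib

open Matrix BigOperators
open scoped ComplexOrder

/-- The matrix unit `|e₀⟩⟨e₀|` in the `(0,0)` entry. -/
noncomputable def E00 (d : ℕ) : Matrix (Fin d) (Fin d) ℂ :=
  Matrix.of fun i j => if (i : ℕ) = 0 ∧ (j : ℕ) = 0 then 1 else 0

/-- The target erasure state `ρ'_ε = (1-ε)·E₀₀ + (ε/(d-1))·(I - E₀₀)`. -/
noncomputable def targetState (d : ℕ) (ε : ℝ) : Matrix (Fin d) (Fin d) ℂ :=
  (1 - ε : ℝ) • E00 d + (ε / ((d : ℝ) - 1)) • (1 - E00 d)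

/-- The matrix logarithm of a Hermitian matrix, via its spectral decomposition
(continuous functional calculus applied to `Real.log`); junk value `0` otherwise. -/
noncomputable def matLog {d : ℕ} (A : Matrix (Fin d) (Fin d) ℂ) :
    Matrix (Fin d) (Fin d) ℂ :=
  if hA : A.IsHermitian then hA.cfc Real.log else 0

/-- The von Neumann entropy `S(ρ) = ∑ᵢ (-λᵢ ln λᵢ)` of a Hermitian matrix. -/
noncomputable def vnEntropy {d : ℕ} (ρ : Matrix (Fin d) (Fin d) ℂ) : ℝ :=
  if hρ : ρ.IsHermitian then ∑ i, Real.negMulLog (hρ.eigenvalues i) else 0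

/-- The straight-line erasure path `ρ_t = ρ + (t/T)·(ρ'_ε - ρ)`. -/
noncomputable def erasurePath {d : ℕ} (ρ : Matrix (Fin d) (Fin d) ℂ) (ε : ℝ)
    (T t : ℕ) : Matrix (Fin d) (Fin d) ℂ :=
  ρ + ((t : ℝ) / (T : ℝ)) • (targetState d ε - ρ)

/-- The dimensionless protocol heat
`βQ = ∑_{t=1}^T Re tr[(ρ_t - ρ_{t-1})·log ρ_t]`. -/
noncomputable def protocolHeat {d : ℕ} (ρ : Matrix (Fin d) (Fin d) ℂ) (ε : ℝ)
    (T : ℕ) : ℝ :=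
  ∑ t ∈ Finset.Icc 1 T,
    ((erasurePath ρ ε T t - erasurePath ρ ε T (t - 1)) *
      matLog (erasurePath ρ ε T t)).trace.re


/-- Joint spectral data of two Hermitian matrices. -/
theorem exists_overlap {d : ℕ} {A B : Matrix (Fin d) (Fin d) ℂ} (hA : A.IsHermitian)
    (hB : B.IsHermitian) :
    ∃ V W : Matrix (Fin d) (Fin d) ℂ, Vᴴ * V = 1 ∧ Wᴴ * W = 1 ∧ W * Wᴴ = 1 ∧
      Vᴴ * A * V = Wᴴ * diagonal (fun i => (hA.eigenvalues i : ℂ)) * W ∧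
      Vᴴ * B * V = diagonal (fun i => (hB.eigenvalues i : ℂ)) ∧
      ∀ f : ℝ → ℝ, hB.cfc f = V * diagonal (fun i => (f (hB.eigenvalues i) : ℂ)) * Vᴴ := by
  set U : Matrix (Fin d) (Fin d) ℂ := hA.eigenvectorUnitary.1 with hU
  set V : Matrix (Fin d) (Fin d) ℂ := hB.eigenvectorUnitary.1 with hV
  have hU1 : Uᴴ * U = 1 := by
    rw [hU, ← star_eq_conjTranspose]; exact Unitary.coe_star_mul_self _
  have hU2 : U * Uᴴ = 1 := by
    rw [hU, ← star_eq_conjTranspose]; exact Unitary.coe_mul_star_self _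
  have hV1 : Vᴴ * V = 1 := by
    rw [hV, ← star_eq_conjTranspose]; exact Unitary.coe_star_mul_self _
  have hV2 : V * Vᴴ = 1 := by
    rw [hV, ← star_eq_conjTranspose]; exact Unitary.coe_mul_star_self _
  have hA' : A = U * diagonal (fun i => (hA.eigenvalues i : ℂ)) * Uᴴ := by
    have := hA.spectral_theorem
    rw [Unitary.conjStarAlgAut_apply] at this
    exact this
  have hB' : B = V * diagonal (fun i => (hB.eigenvalues i : ℂ)) * Vᴴ := by
    have := hB.spectral_theorem
    rw [Unitary.conjStarAlgAut_apply] at this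
    exact this
  refine ⟨V, Uᴴ * V, hV1, ?_, ?_, ?_, ?_, ?_⟩
  · calc (Uᴴ * V)ᴴ * (Uᴴ * V) = Vᴴ * (U * Uᴴ) * V := by
          simp only [conjTranspose_mul, conjTranspose_conjTranspose, Matrix.mul_assoc]
      _ = 1 := by rw [hU2, Matrix.mul_one, hV1]
  · calc (Uᴴ * V) * (Uᴴ * V)ᴴ = Uᴴ * (V * Vᴴ) * U := by
          simp only [conjTranspose_mul, conjTranspose_conjTranspose, Matrix.mul_assoc]
      _ = 1 := by rw [hV2, Matrix.mul_one, hU1]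
  · conv_lhs => rw [hA']
    simp only [conjTranspose_mul, conjTranspose_conjTranspose, Matrix.mul_assoc]
  · conv_lhs => rw [hB']
    calc _ = (Vᴴ * V) * diagonal (fun i => (hB.eigenvalues i : ℂ)) * (Vᴴ * V) := by
          simp only [Matrix.mul_assoc]
      _ = _ := by rw [hV1, Matrix.one_mul, Matrix.mul_one]
  · intro f
    rw [IsHermitian.cfc, Unitary.conjStarAlgAut_apply]
    rfl

theorem row_sum {d : ℕ} {W : Matrix (Fin d) (Fin d) ℂ} (h : W * Wᴴ = 1) (i : Fin d) :
    ∑ j, Complex.normSq (W i j) = 1 := by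
  have := congrFun (congrFun h i) i
  simp only [Matrix.mul_apply, conjTranspose_apply, one_apply_eq, Complex.star_def,
    Complex.mul_conj] at this
  exact_mod_cast this

theorem col_sum {d : ℕ} {W : Matrix (Fin d) (Fin d) ℂ} (h : Wᴴ * W = 1) (j : Fin d) :
    ∑ i, Complex.normSq (W i j) = 1 := by
  have := congrFun (congrFun h j) j
  simp only [Matrix.mul_apply, conjTranspose_apply, one_apply_eq, Complex.star_def,
    ← Complex.normSq_eq_conj_mul_self] at this
  exact_mod_cast this

theorem trace_overlap {d : ℕ} {A V W : Matrix (Fin d) (Fin d) ℂ} {p : Fin d → ℝ}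
    (h : Vᴴ * A * V = Wᴴ * diagonal (fun i => (p i : ℂ)) * W) (g : Fin d → ℝ) :
    (A * (V * diagonal (fun i => (g i : ℂ)) * Vᴴ)).trace.re
      = ∑ i, ∑ j, p i * Complex.normSq (W i j) * g j := by
  have h1 : (A * (V * diagonal (fun i => (g i : ℂ)) * Vᴴ)).trace
      = (Wᴴ * diagonal (fun i => (p i : ℂ)) * W * diagonal (fun i => (g i : ℂ))).trace := by
    rw [← h, ← Matrix.mul_assoc, trace_mul_comm]
    simp only [Matrix.mul_assoc]
  have h2 : (Wᴴ * diagonal (fun i => (p i : ℂ)) * W * diagonal (fun i => (g i : ℂ))).trace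
      = ((∑ i, ∑ j, p i * Complex.normSq (W i j) * g j : ℝ) : ℂ) := by
    rw [Finset.sum_comm]
    push_cast
    simp only [trace, diag_apply, mul_diagonal, Matrix.mul_apply (N := W), conjTranspose_apply,
      Complex.star_def, Finset.sum_mul, Complex.normSq_eq_conj_mul_self]
    refine Finset.sum_congr rfl fun i _ => Finset.sum_congr rfl fun j _ => ?_
    ring
  rw [h1, h2, Complex.ofReal_re]

theorem overlap_test {d : ℕ} {W : Matrix (Fin d) (Fin d) ℂ} {p q : Fin d → ℝ} {s : ℝ}
    (hp : ∀ i, 0 ≤ p i) (hq : ∀ i, 0 < q i) (hs : 0 < s) (hW : W * Wᴴ = 1)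
    (hpsd : (diagonal (fun i => (q i : ℂ)) -
      s • (Wᴴ * diagonal (fun i => (p i : ℂ)) * W)).PosSemidef) (i : Fin d) :
    s * p i * ∑ j, Complex.normSq (W i j) / q j ≤ 1 := by
  set r := ∑ j, Complex.normSq (W i j) / q j with hr
  have hr0 : 0 < r := by
    have h1 := row_sum hW i
    by_contra hcon
    have h0 : ∀ j ∈ Finset.univ, 0 ≤ Complex.normSq (W i j) / q j := fun j _ =>
      div_nonneg (Complex.normSq_nonneg _) (hq j).le
    have h2 : r = 0 := le_antisymm (not_lt.mp hcon) (Finset.sum_nonneg h0)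
    rw [hr, Finset.sum_eq_zero_iff_of_nonneg h0] at h2
    have h3 : ∑ j, Complex.normSq (W i j) = 0 := Finset.sum_eq_zero fun j hj => by
      have := h2 j hj
      rcases div_eq_zero_iff.mp this with h | h
      · exact h
      · exact absurd h (hq j).ne'
    rw [h3] at h1
    exact zero_ne_one h1
  set x : Fin d → ℂ := fun j => star (W i j) / (q j : ℂ) with hx
  have hWx : (W *ᵥ x) i = (r : ℂ) := by
    simp only [mulVec, dotProduct, hx, hr]
    push_cast
    refine Finset.sum_congr rfl fun j _ => ?_
    rw [Complex.star_def, ← mul_div_assoc, Complex.mul_conj]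
  have hdiag : ∀ (y : Fin d → ℂ) (g : Fin d → ℝ),
      star y ⬝ᵥ (diagonal (fun i => (g i : ℂ)) *ᵥ y)
        = ((∑ k, g k * Complex.normSq (y k) : ℝ) : ℂ) := by
    intro y g
    simp only [dotProduct, mulVec_diagonal, Pi.star_apply]
    push_cast
    refine Finset.sum_congr rfl fun j _ => ?_
    rw [Complex.normSq_eq_conj_mul_self, Complex.star_def]; ring
  have h := hpsd.dotProduct_mulVec_nonneg x
  have hB : star x ⬝ᵥ ((Wᴴ * diagonal (fun i => (p i : ℂ)) * W) *ᵥ x)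
      = star (W *ᵥ x) ⬝ᵥ (diagonal (fun i => (p i : ℂ)) *ᵥ (W *ᵥ x)) := by
    rw [← mulVec_mulVec, ← mulVec_mulVec, star_mulVec, dotProduct_mulVec, dotProduct_mulVec,
      dotProduct_mulVec]
  rw [sub_mulVec, dotProduct_sub, smul_mulVec, dotProduct_smul, hB, hdiag, hdiag,
    Complex.real_smul, ← Complex.ofReal_mul, ← Complex.ofReal_sub,
    ← Complex.ofReal_zero, Complex.real_le_real] at h
  have e1 : ∑ k, q k * Complex.normSq (x k) = r := by
    rw [hr]
    refine Finset.sum_congr rfl fun j _ => ?_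
    have := (hq j).ne'
    rw [hx]
    simp only [Complex.star_def, map_div₀, Complex.normSq_conj, Complex.normSq_ofReal]
    field_simp
  have e2 : p i * r ^ 2 ≤ ∑ k, p k * Complex.normSq ((W *ᵥ x) k) := by
    have := Finset.single_le_sum (f := fun k => p k * Complex.normSq ((W *ᵥ x) k))
      (fun k _ => mul_nonneg (hp k) (Complex.normSq_nonneg _)) (Finset.mem_univ i)
    simp only [hWx, Complex.normSq_ofReal] at this
    rwa [pow_two]
  rw [e1] at h
  have e3 := mul_le_mul_of_nonneg_left e2 hs.le
  by_contra hcon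
  push Not at hcon
  nlinarith

theorem matLog_eq {d : ℕ} {A : Matrix (Fin d) (Fin d) ℂ} (hA : A.IsHermitian) :
    matLog A = hA.cfc Real.log := by
  rw [matLog, dif_pos hA]

theorem trace_re_eq {d : ℕ} {A : Matrix (Fin d) (Fin d) ℂ} (hA : A.IsHermitian) :
    A.trace.re = ∑ i, hA.eigenvalues i := by
  rw [hA.trace_eq_sum_eigenvalues]
  simp

theorem self_log {d : ℕ} {A : Matrix (Fin d) (Fin d) ℂ} (hA : A.IsHermitian) :
    (A * matLog A).trace.re = - vnEntropy A := by
  obtain ⟨V, W, hV, -, -, -, hB, hf⟩ := exists_overlap hA hA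
  rw [matLog_eq hA, vnEntropy, dif_pos hA, hf]
  have h' : Vᴴ * A * V = (1 : Matrix (Fin d) (Fin d) ℂ)ᴴ *
      diagonal (fun i => (hA.eigenvalues i : ℂ)) * 1 := by
    rw [hB]; simp
  rw [trace_overlap h', ← Finset.sum_neg_distrib]
  refine Finset.sum_congr rfl fun i _ => ?_
  rw [Finset.sum_eq_single i]
  · simp [Real.negMulLog]
  · intro j _ hj
    simp [Matrix.one_apply_ne hj.symm]
  · simp

/-- Klein's inequality. -/
theorem klein {d : ℕ} {A B : Matrix (Fin d) (Fin d) ℂ} (hA : A.PosSemidef)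
    (hB : B.PosDef) (htr : A.trace = B.trace) :
    (A * matLog B).trace.re ≤ - vnEntropy A := by
  obtain ⟨V, W, hV, hW1, hW2, hAV, hBV, hf⟩ := exists_overlap hA.1 hB.1
  rw [matLog_eq hB.1, vnEntropy, dif_pos hA.1, hf, trace_overlap hAV]
  set p := hA.1.eigenvalues with hp
  set q := hB.1.eigenvalues with hq
  have hp0 : ∀ i, 0 ≤ p i := hA.eigenvalues_nonneg
  have hq0 : ∀ i, 0 < q i := hB.eigenvalues_pos
  have key : ∀ i j, p i * Complex.normSq (W i j) * Real.log (q j) ≤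
      Complex.normSq (W i j) * (- Real.negMulLog (p i) + (q j - p i)) := by
    intro i j
    have hw := Complex.normSq_nonneg (W i j)
    have : p i * Real.log (q j) ≤ - Real.negMulLog (p i) + (q j - p i) := by
      rcases (hp0 i).eq_or_lt with h | h
      · rw [← h]; simp [(hq0 j).le]
      · have h1 := Real.log_le_sub_one_of_pos (div_pos (hq0 j) h)
        rw [Real.log_div (hq0 j).ne' h.ne'] at h1
        have h2 := mul_le_mul_of_nonneg_left h1 h.le
        have h3 : p i * (q j / p i - 1) = q j - p i := by field_simp
        rw [h3] at h2
        rw [Real.negMulLog]; linarith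
    nlinarith [mul_le_mul_of_nonneg_left this hw]
  have hsum : ∑ i, p i = ∑ j, q j := by
    rw [← trace_re_eq, ← trace_re_eq, htr]
  calc _ ≤ ∑ i, ∑ j, Complex.normSq (W i j) * (- Real.negMulLog (p i) + (q j - p i)) :=
        Finset.sum_le_sum fun i _ => Finset.sum_le_sum fun j _ => key i j
    _ = ∑ i, (- Real.negMulLog (p i) - p i) * ∑ j, Complex.normSq (W i j)
        + ∑ j, q j * ∑ i, Complex.normSq (W i j) := by
        simp only [Finset.mul_sum]
        rw [Finset.sum_comm (s := Finset.univ) (t := Finset.univ)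
          (f := fun j i => q j * Complex.normSq (W i j)), ← Finset.sum_add_distrib]
        refine Finset.sum_congr rfl fun i _ => ?_
        rw [← Finset.sum_add_distrib]
        refine Finset.sum_congr rfl fun j _ => ?_
        ring
    _ = _ := by
        simp only [row_sum hW2, col_sum hW1, mul_one, Finset.sum_sub_distrib,
          Finset.sum_neg_distrib, hsum]
        ring

/-- Relative entropy upper bound from the operator inequality `s A ≤ B`. -/
theorem dmax_bound {d : ℕ} {A B : Matrix (Fin d) (Fin d) ℂ} (hA : A.PosSemidef)
    (hB : B.PosDef) {s : ℝ} (hs : 0 < s) (hAB : (B - s • A).PosSemidef) (htr : A.trace = 1) :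
    - vnEntropy A + Real.log s ≤ (A * matLog B).trace.re := by
  obtain ⟨V, W, hV, hW1, hW2, hAV, hBV, hf⟩ := exists_overlap hA.1 hB.1
  rw [matLog_eq hB.1, vnEntropy, dif_pos hA.1, hf, trace_overlap hAV]
  have hsum : ∑ i, hA.1.eigenvalues i = 1 := by
    rw [← trace_re_eq, htr]; simp
  have hp0 : ∀ i, 0 ≤ hA.1.eigenvalues i := hA.eigenvalues_nonneg
  have hq0 : ∀ i, 0 < hB.1.eigenvalues i := hB.eigenvalues_pos
  have hpsd := hAB.conjTranspose_mul_mul_same V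
  rw [Matrix.mul_sub, Matrix.sub_mul, Matrix.mul_smul, Matrix.smul_mul, hAV, hBV] at hpsd
  have ht := overlap_test hp0 hq0 hs hW2 hpsd
  set p := hA.1.eigenvalues with hp
  set q := hB.1.eigenvalues with hq
  have e : - ∑ i, Real.negMulLog (p i) + Real.log s
      = ∑ i, (p i * (Real.log (p i) + Real.log s)) := by
    simp only [Real.negMulLog, mul_add, Finset.sum_add_distrib, ← Finset.sum_mul, hsum]
    simp
  rw [e]
  refine Finset.sum_le_sum fun i _ => ?_
  rcases (hp0 i).eq_or_lt with h | h
  · rw [← h]; simp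
  simp only [mul_assoc (p i), ← Finset.mul_sum]
  refine mul_le_mul_of_nonneg_left ?_ h.le
  have hm : 0 < s * p i := mul_pos hs h
  have key : ∀ j, Complex.normSq (W i j) * (Real.log (p i) + Real.log s + 1)
      - s * p i * (Complex.normSq (W i j) / q j) ≤ Complex.normSq (W i j) * Real.log (q j) := by
    intro j
    have h1 := Real.log_le_sub_one_of_pos (div_pos hm (hq0 j))
    rw [Real.log_div hm.ne' (hq0 j).ne', Real.log_mul hs.ne' h.ne'] at h1
    have h2 := mul_le_mul_of_nonneg_left h1 (Complex.normSq_nonneg (W i j))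
    have h3 : s * p i * (Complex.normSq (W i j) / q j)
      = Complex.normSq (W i j) * (s * p i / q j) := by ring
    rw [h3]
    linarith
  have := Finset.sum_le_sum fun j (_ : j ∈ Finset.univ) => key j
  rw [Finset.sum_sub_distrib, ← Finset.sum_mul, ← Finset.mul_sum, row_sum hW2] at this
  linarith [ht i]

theorem targetState_eq (d : ℕ) (ε : ℝ) : targetState d ε =
    diagonal (fun i : Fin d => (((if (i : ℕ) = 0 then 1 - ε else ε / ((d : ℝ) - 1)) : ℝ) : ℂ)) := by
  ext i j
  by_cases hij : i = j
  · subst hij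
    by_cases hi : (i : ℕ) = 0
    · simp [targetState, E00, hi]
    · simp [targetState, E00, hi]
  · have : ¬ ((i : ℕ) = 0 ∧ (j : ℕ) = 0) := fun h => hij (Fin.ext (h.1.trans h.2.symm))
    simp [targetState, E00, hij, this]

theorem targetState_trace (d : ℕ) (hd : 2 ≤ d) (ε : ℝ) : (targetState d ε).trace = 1 := by
  rw [targetState_eq, trace_diagonal, ← Complex.ofReal_sum, ← Complex.ofReal_one]
  congr 1
  obtain ⟨n, rfl⟩ : ∃ n, d = n + 1 := ⟨d - 1, by omega⟩
  have hn : (n : ℝ) ≠ 0 := by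
    have : n ≠ 0 := by omega
    exact_mod_cast this
  rw [Fin.sum_univ_succ]
  simp
  field_simp
  ring

theorem diag_sub_psd {d : ℕ} (g : Fin d → ℝ) (c : ℝ) (h : ∀ i, c ≤ g i) :
    (diagonal (fun i => (g i : ℂ)) - c • (1 : Matrix (Fin d) (Fin d) ℂ)).PosSemidef := by
  have : diagonal (fun i => (g i : ℂ)) - c • (1 : Matrix (Fin d) (Fin d) ℂ)
      = diagonal (fun i => ((g i - c : ℝ) : ℂ)) := by
    ext i j
    by_cases hij : i = j
    · subst hij; simp
    · simp [hij]
  rw [this, posSemidef_diagonal_iff]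
  intro i
  exact_mod_cast sub_nonneg.mpr (h i)

theorem one_sub_psd {d : ℕ} {ρ : Matrix (Fin d) (Fin d) ℂ} (hρ : ρ.PosSemidef)
    (htr : ρ.trace = 1) : (1 - ρ).PosSemidef := by
  obtain ⟨V, W, hV, hW1, hW2, hAV, hBV, hf⟩ := exists_overlap hρ.1 hρ.1
  have hV2 : V * Vᴴ = 1 := mul_eq_one_comm.mp hV
  have hsum : ∑ i, hρ.1.eigenvalues i = 1 := by
    rw [← trace_re_eq, htr]; simp
  have hle : ∀ i, hρ.1.eigenvalues i ≤ 1 := fun i => by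
    rw [← hsum]
    exact Finset.single_le_sum (fun k _ => hρ.eigenvalues_nonneg k) (Finset.mem_univ i)
  have e : 1 - ρ = V * (diagonal (fun i => ((-hρ.1.eigenvalues i : ℝ) : ℂ))
      - (-1 : ℝ) • (1 : Matrix (Fin d) (Fin d) ℂ)) * Vᴴ := by
    have h1 : ρ = V * diagonal (fun i => (hρ.1.eigenvalues i : ℂ)) * Vᴴ := by
      rw [← hBV]
      calc ρ = (V * Vᴴ) * ρ * (V * Vᴴ) := by rw [hV2]; simp
        _ = _ := by simp only [Matrix.mul_assoc]
    have h2 : diagonal (fun i => ((-hρ.1.eigenvalues i : ℝ) : ℂ))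
      = - diagonal (fun i => (hρ.1.eigenvalues i : ℂ)) := by
      rw [diagonal_neg]; congr 1; ext i; simp
    rw [h2]
    conv_lhs => rw [h1, ← hV2]
    simp only [neg_smul, one_smul, sub_neg_eq_add, Matrix.mul_add, Matrix.add_mul,
      Matrix.mul_neg, Matrix.neg_mul, Matrix.mul_one]
    abel
  rw [e]
  exact (diag_sub_psd _ _ (fun i => neg_le_neg (hle i))).mul_mul_conjTranspose_same V

theorem scalar_bound {k ε η T : ℝ} (hk : 1 ≤ k) (hε : 0 < ε) (hη : 0 < η) (hT0 : 0 < T)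
    (hT : (Real.exp 1 + 1) / (Real.exp 1 * η) *
        Real.log ((Real.exp 1 + 1) * k ^ 2 / (ε * η)) ≤ T) :
    1 + Real.log T + Real.log (k / ε) ≤ η * T := by
  have hk0 : 0 < k := by linarith
  have he := Real.exp_pos 1
  set e := Real.exp 1 with hedef
  have hL : 0 < η * T := mul_pos hη hT0
  have h1 := Real.log_le_sub_one_of_pos (div_pos hL (by linarith : 0 < e + 1))
  rw [Real.log_div hL.ne' (by positivity), Real.log_mul hη.ne' hT0.ne'] at h1
  rw [Real.log_div (by positivity) (by positivity), Real.log_mul (by positivity) (by positivity),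
    Real.log_mul hε.ne' hη.ne', Real.log_pow] at hT
  push_cast at hT
  rw [Real.log_div hk0.ne' hε.ne']
  have hlk := Real.log_nonneg hk
  set L := η * T
  have h2 : (e + 1) * (Real.log (e + 1) + 2 * Real.log k - (Real.log ε + Real.log η)) ≤ e * L := by
    have := mul_le_mul_of_nonneg_left hT (mul_pos he hη).le
    have h3 : e * η * ((e + 1) / (e * η) * (Real.log (e + 1) + 2 * Real.log k -
      (Real.log ε + Real.log η))) = (e + 1) * (Real.log (e + 1) + 2 * Real.log k -
      (Real.log ε + Real.log η)) := by field_simp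
    rw [h3] at this
    calc _ ≤ _ := this
      _ = _ := by ring
  have h4 := mul_le_mul_of_nonneg_left h1 (by linarith : 0 ≤ e + 1)
  have h5 : (e + 1) * (L / (e + 1) - 1) = L - (e + 1) := by field_simp
  rw [h5] at h4
  have h6 : (e + 1) * (1 + Real.log T + (2 * Real.log k - Real.log ε)) ≤ (e + 1) * L := by
    linarith
  have h7 := le_of_mul_le_mul_left h6 (by linarith)
  linarith

theorem T_ge_two {k ε η : ℝ} (hk : 1 ≤ k) (hε : 0 < ε) (hε1 : ε ≤ 1 / 2) (hη : 0 < η)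
    (hη1 : η ≤ 1) :
    1 < (Real.exp 1 + 1) / (Real.exp 1 * η) *
        Real.log ((Real.exp 1 + 1) * k ^ 2 / (ε * η)) := by
  have he := Real.exp_pos 1
  have h1 : 1 < (Real.exp 1 + 1) / (Real.exp 1 * η) := by
    rw [one_lt_div (by positivity)]; nlinarith
  have h2 : 1 ≤ Real.log ((Real.exp 1 + 1) * k ^ 2 / (ε * η)) := by
    rw [Real.le_log_iff_exp_le (by positivity), le_div_iff₀ (by positivity)]
    have : ε * η ≤ 1 := by nlinarith
    have : 1 ≤ k ^ 2 := by nlinarith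
    nlinarith
  nlinarith

theorem path_eq {d : ℕ} (ρ : Matrix (Fin d) (Fin d) ℂ) (ε : ℝ) (T t : ℕ) :
    erasurePath ρ ε T t = (1 - (t : ℝ) / T) • ρ + ((t : ℝ) / T) • targetState d ε := by
  rw [erasurePath, smul_sub, sub_smul, one_smul]; abel

theorem path_step {d : ℕ} (ρ : Matrix (Fin d) (Fin d) ℂ) (ε : ℝ) (T t : ℕ) :
    erasurePath ρ ε T (t + 1) - erasurePath ρ ε T t
      = (1 / (T : ℝ)) • (targetState d ε - ρ) := by
  rw [erasurePath, erasurePath, add_sub_add_left_eq_sub, ← sub_smul]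
  congr 1
  push_cast
  ring

/-- **Finite Landauer-erasure bound** (Theorem 1, explicit-protocol form). -/
theorem finite_landauer_erasure_bound
    (d : ℕ) (hd : 2 ≤ d) (ε η : ℝ)
    (hε : ε ∈ Set.Ioc (0 : ℝ) (1 / 2)) (hη : η ∈ Set.Ioc (0 : ℝ) 1)
    (ρ : Matrix (Fin d) (Fin d) ℂ) (hρ : ρ.PosSemidef) (htr : ρ.trace = 1)
    (T : ℕ)
    (hT : T = ⌈(Real.exp 1 + 1) / (Real.exp 1 * η) *
        Real.log ((Real.exp 1 + 1) * ((d : ℝ) - 1) ^ 2 / (ε * η))⌉₊) :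
    1 - targetState d ε ⟨0, by omega⟩ ⟨0, by omega⟩ = (ε : ℂ) ∧
    vnEntropy ρ - vnEntropy (targetState d ε) ≤ protocolHeat ρ ε T ∧
    protocolHeat ρ ε T - (vnEntropy ρ - vnEntropy (targetState d ε)) ≤ η := by
  obtain ⟨hε0, hε1⟩ := hε
  obtain ⟨hη0, hη1⟩ := hη
  have hd' : (2 : ℝ) ≤ d := by exact_mod_cast hd
  have hk : (1 : ℝ) ≤ (d : ℝ) - 1 := by linarith
  have hk0 : (0 : ℝ) < (d : ℝ) - 1 := by linarith
  have hT2 : 2 ≤ T := by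
    have := Nat.lt_ceil.mpr (show ((1 : ℕ) : ℝ) < _ by
      simpa using T_ge_two hk hε0 hε1 hη0 hη1)
    omega
  have hTle := Nat.le_ceil ((Real.exp 1 + 1) / (Real.exp 1 * η) *
        Real.log ((Real.exp 1 + 1) * ((d : ℝ) - 1) ^ 2 / (ε * η)))
  rw [← hT] at hTle
  have hTr : (2 : ℝ) ≤ T := by exact_mod_cast hT2
  have hT0 : (0 : ℝ) < T := by linarith
  have hscal := scalar_bound hk hε0 hη0 hT0 hTle
  refine ⟨by rw [targetState_eq]; simp, ?_⟩
  have hc0 : 0 < ε / ((d : ℝ) - 1) := div_pos hε0 hk0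
  have hc1 : ε / ((d : ℝ) - 1) ≤ 1 - ε :=
    (div_le_self hε0.le hk).trans (by linarith)
  have hσpd : (targetState d ε).PosDef := by
    rw [targetState_eq, posDef_diagonal_iff]
    intro i
    have : 0 < (if (i : ℕ) = 0 then 1 - ε else ε / ((d : ℝ) - 1)) := by
      split_ifs <;> linarith
    exact_mod_cast this
  have hσc : (targetState d ε - (ε / ((d : ℝ) - 1)) • ρ).PosSemidef := by
    have h1 : (targetState d ε - (ε / ((d : ℝ) - 1)) • 1).PosSemidef := by
      rw [targetState_eq]
      exact diag_sub_psd _ _ (fun i => by split_ifs <;> linarith)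
    have h2 := h1.add ((one_sub_psd hρ htr).smul hc0.le)
    have e : targetState d ε - (ε / ((d : ℝ) - 1)) • ρ
      = targetState d ε - (ε / ((d : ℝ) - 1)) • 1 + (ε / ((d : ℝ) - 1)) • (1 - ρ) := by
      rw [smul_sub]; abel
    rw [e]; exact h2
  have hσtr := targetState_trace d hd ε
  have hpath := path_eq ρ ε T
  have hstep := path_step ρ ε T
  have hPH : protocolHeat ρ ε T = ∑ t ∈ Finset.Icc 1 T,
    ((erasurePath ρ ε T t - erasurePath ρ ε T (t - 1)) *
      matLog (erasurePath ρ ε T t)).trace.re := rfl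
  rw [hPH]
  set σ := targetState d ε with hσ
  set s := erasurePath ρ ε T with hs
  have hs0 : s 0 = ρ := by rw [hpath]; simp
  have hsT : s T = σ := by rw [hpath, div_self hT0.ne']; simp
  have hpd : ∀ t, 1 ≤ t → t ≤ T → (s t).PosDef := by
    intro t h1 h2
    have h1' : (0 : ℝ) < t := by exact_mod_cast h1
    have h2' : (t : ℝ) ≤ T := by exact_mod_cast h2
    rw [hpath]
    refine PosDef.posSemidef_add (hρ.smul ?_) (hσpd.smul (div_pos h1' hT0))
    rw [sub_nonneg, div_le_one hT0]; exact h2'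
  have hpsd : ∀ t, t ≤ T → (s t).PosSemidef := by
    intro t h2
    rcases Nat.eq_zero_or_pos t with h | h
    · rw [h, hs0]; exact hρ
    · exact (hpd t h h2).posSemidef
  have hstr : ∀ t, (s t).trace = 1 := by
    intro t
    rw [hpath, trace_add, trace_smul, trace_smul, htr, hσtr, ← add_smul]
    simp
  set F : ℕ → ℝ := fun t => ((s t - s (t - 1)) * matLog (s t)).trace.re with hF
  have hlow : ∀ n, n ≤ T → vnEntropy ρ - vnEntropy (s n) ≤ ∑ t ∈ Finset.Icc 1 n, F t := by
    intro n
    induction n with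
    | zero => intro _; simp [hs0]
    | succ n ih =>
      intro hn
      rw [Finset.sum_Icc_succ_top (by omega)]
      have h1 := ih (by omega)
      have h2 := klein (hpsd n (by omega)) (hpd (n + 1) (by omega) hn)
        ((hstr n).trans (hstr (n + 1)).symm)
      have h3 := self_log (hpd (n + 1) (by omega) hn).1
      have h4 : F (n + 1) = (s (n + 1) * matLog (s (n + 1))).trace.re
          - (s n * matLog (s (n + 1))).trace.re := by
        simp only [hF, Nat.add_sub_cancel, Matrix.sub_mul, trace_sub, Complex.sub_re]
      linarith
  have hup : ∀ n, n + 1 ≤ T →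
      ∑ t ∈ Finset.Icc 1 n, F t ≤ vnEntropy (s 1) - vnEntropy (s (n + 1)) := by
    intro n
    induction n with
    | zero => intro _; simp
    | succ n ih =>
      intro hn
      rw [Finset.sum_Icc_succ_top (by omega)]
      have h1 := ih (by omega)
      have h2 := klein (hpsd (n + 2) hn) (hpd (n + 1) (by omega) (by omega))
        ((hstr (n + 2)).trans (hstr (n + 1)).symm)
      have h3 := self_log (hpd (n + 1) (by omega) (by omega)).1
      have h4 : F (n + 1) = (s (n + 2) * matLog (s (n + 1))).trace.re
          - (s (n + 1) * matLog (s (n + 1))).trace.re := by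
        simp only [hF, Nat.add_sub_cancel]
        rw [hstep n, ← hstep (n + 1), Matrix.sub_mul, trace_sub, Complex.sub_re]
      linarith
  refine ⟨by simpa only [hsT] using hlow T le_rfl, ?_⟩
  obtain ⟨m, rfl⟩ : ∃ m, T = m + 1 := ⟨T - 1, by omega⟩
  change ∑ t ∈ Finset.Icc 1 (m + 1), F t - _ ≤ _
  rw [Finset.sum_Icc_succ_top (by omega)]
  have hupm := hup m le_rfl
  rw [hsT] at hupm
  set T : ℝ := ((m + 1 : ℕ) : ℝ) with hTdef
  have hu0 : 0 < 1 / T := by positivity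
  have hu1 : 0 < 1 - 1 / T := by
    rw [sub_pos, div_lt_one hT0]; linarith
  have hs1 : s 1 = (1 - 1 / T) • ρ + (1 / T) • σ := by rw [hpath]; simp
  have hpd1 := hpd 1 le_rfl (by omega)
  have hA := dmax_bound hρ hpd1 hu1 (by
    rw [hs1, add_sub_cancel_left]; exact hσpd.posSemidef.smul hu0.le) htr
  have hB := dmax_bound hσpd.posSemidef hpd1 hu0 (by
    rw [hs1, add_sub_cancel_right]; exact hρ.smul hu1.le) hσtr
  have hC := dmax_bound hρ hσpd hc0 hσc htr
  have hD := self_log hpd1.1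
  have hE : (s 1 * matLog (s 1)).trace.re = (1 - 1 / T) * (ρ * matLog (s 1)).trace.re
      + (1 / T) * (σ * matLog (s 1)).trace.re := by
    conv_lhs => rw [show s 1 * matLog (s 1) = ((1 - 1 / T) • ρ + (1 / T) • σ) * matLog (s 1) by
      rw [← hs1]]
    rw [Matrix.add_mul, Matrix.smul_mul, Matrix.smul_mul, trace_add, trace_smul, trace_smul,
      Complex.add_re, Complex.smul_re, Complex.smul_re, smul_eq_mul, smul_eq_mul]
  have hFm : F (m + 1) = (1 / T) * ((σ * matLog σ).trace.re - (ρ * matLog σ).trace.re) := by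
    simp only [hF, Nat.add_sub_cancel]
    rw [hstep m, hsT, Matrix.smul_mul, Matrix.sub_mul, trace_smul, trace_sub, Complex.smul_re,
      Complex.sub_re, smul_eq_mul]
  have hG := self_log hσpd.1
  have hlog1 : Real.log (1 / T) = - Real.log T := by rw [one_div, Real.log_inv]
  have hlog2 : Real.log (ε / ((d : ℝ) - 1)) = - Real.log (((d : ℝ) - 1) / ε) := by
    rw [← Real.log_inv, inv_div]
  have hlog3 : - (1 / T) ≤ (1 - 1 / T) * Real.log (1 - 1 / T) := by
    have h := Real.one_sub_inv_le_log_of_pos hu1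
    have h' := mul_le_mul_of_nonneg_left h hu1.le
    rw [mul_sub, mul_inv_cancel₀ hu1.ne'] at h'
    linarith
  rw [hlog1] at hB
  rw [hlog2] at hC
  have hA' := mul_le_mul_of_nonneg_left hA hu1.le
  have hB' := mul_le_mul_of_nonneg_left hB hu0.le
  have hC' := mul_le_mul_of_nonneg_left hC hu0.le
  have hS' := mul_le_mul_of_nonneg_left hscal hu0.le
  have hη' : 1 / T * (η * T) = η := by field_simp
  rw [hη'] at hS'
  rw [hG] at hFm
  nlinarith
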